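/- Let (λ_j)_{j≥1} be a nondecreasing sequence of positive reals, L ≥ 1, δ ∈ (0, 1/30], ℏ ∈ (0, 1/2], N ≥ 1 with λ_N ≥ exp(60L²/ℏ) and 1 ≤ λ_{N+1} − λ_N ≤ 2L, and let k satisfy ℏ·log λ_N ≤ k < λ_N/2. Let T : ℓ² → ℓ² be a linear map with ‖T u‖ ≤ L·‖u‖ for all u ∈ ℓ², satisfying the spatial averaging condition ‖R_{k,N}(T(R_{k,N} u))‖ ≤ δ·‖u‖ for all u ∈ ℓ². Then for every v ∈ ℓ² with Σ_j λ_j^{5/4} v_j² < ∞, writing p = P_N v and q = Q_N v, one has: (λ_{N+1}^{5/4} + λ_N^{5/4})·(‖q‖² − ‖p‖²) − 2·(‖A^{5/8} q‖² − ‖A^{5/8} p‖²) + 2·⟨T v, A^{1/4} p − A^{1/4} q⟩ ≤ −(5/16)·λ_N^{1/4}·‖v‖². -/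

import Mathlib

noncomputable section

/-- `Plow N v` keeps the entries with index `j ≤ N` (the projector `P_N`). -/
def Plow (N : ℕ+) (v : ℕ+ → ℝ) : ℕ+ → ℝ := fun j => if j ≤ N then v j else 0

/-- `Qhigh N v` keeps the entries with index `j > N` (the projector `Q_N`). -/
def Qhigh (N : ℕ+) (v : ℕ+ → ℝ) : ℕ+ → ℝ := fun j => if j ≤ N then 0 else v j

/-- `PkOp lam k N v` keeps exactly the entries with `λ_j < λ_N − k`. -/
def PkOp (lam : ℕ+ → ℝ) (k : ℝ) (N : ℕ+) (v : ℕ+ → ℝ) : ℕ+ → ℝ :=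
  fun j => if lam j < lam N - k then v j else 0

/-- `RkOp lam k N v` keeps exactly the entries with `λ_N − k ≤ λ_j ≤ λ_N + k`. -/
def RkOp (lam : ℕ+ → ℝ) (k : ℝ) (N : ℕ+) (v : ℕ+ → ℝ) : ℕ+ → ℝ :=
  fun j => if lam N - k ≤ lam j ∧ lam j ≤ lam N + k then v j else 0

/-- `QkOp lam k N v` keeps exactly the entries with `λ_j > λ_N + k`. -/
def QkOp (lam : ℕ+ → ℝ) (k : ℝ) (N : ℕ+) (v : ℕ+ → ℝ) : ℕ+ → ℝ :=
  fun j => if lam N + k < lam j then v j else 0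

/-- Squared `ℓ²` norm. -/
def nsq (v : ℕ+ → ℝ) : ℝ := ∑' j, (v j) ^ 2

/-- Squared norm `‖A^s v‖² = Σ_j λ_j^{2s} v_j²` of the diagonal operator power. -/
def asq (lam : ℕ+ → ℝ) (s : ℝ) (v : ℕ+ → ℝ) : ℝ := ∑' j, lam j ^ (2 * s) * (v j) ^ 2

theorem aux_gap (X m : ℝ) (hm : 0 < m) (hX : 0 < X) (hg : 1 ≤ X ^ 4 - m ^ 4) :
    5 / 4 * m ≤ X ^ 5 - m ^ 5 := by
  have h1 : 0 ≤ 4 * X ^ 5 - 5 * m * X ^ 4 + m ^ 5 := by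
    have : 4 * X ^ 5 - 5 * m * X ^ 4 + m ^ 5
        = (X - m) ^ 2 * (4 * X ^ 3 + 3 * X ^ 2 * m + 2 * X * m ^ 2 + m ^ 3) := by ring
    rw [this]; positivity
  nlinarith [mul_le_mul_of_nonneg_left hg hm.le]

theorem aux_in (D x m a b v L e : ℝ) (hm : 0 < m) (hD : 5 / 4 * m ≤ D) (hx0 : 0 < x)
    (hx : x ≤ 12 / 10 * m) (he : 0 < e) (heL : e * L ^ 2 = 1 / 4) :
    -D * v ^ 2 + 2 * ((a + b) * (x * v)) ≤
      m * (-(5 / 16) * v ^ 2 + 36 * (a ^ 2 - 1 / 900 * v ^ 2) + 48 / 10 * (b ^ 2 - L ^ 2 * 0 ^ 2)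
        + e * ((a + b) ^ 2 - L ^ 2 * v ^ 2)) := by
  have h1 : 2 * (a * (x * v)) ≤ 12 / 10 * m * (30 * a ^ 2 + v ^ 2 / 30) := by
    have : 2 * (a * v) ≤ 30 * a ^ 2 + v ^ 2 / 30 := by nlinarith [sq_nonneg (30 * a - v)]
    calc 2 * (a * (x * v)) = x * (2 * (a * v)) := by ring
      _ ≤ x * (30 * a ^ 2 + v ^ 2 / 30) := by gcongr
      _ ≤ _ := by gcongr
  have h2 : 2 * (b * (x * v)) ≤ 12 / 10 * m * (4 * b ^ 2 + v ^ 2 / 4) := by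
    have : 2 * (b * v) ≤ 4 * b ^ 2 + v ^ 2 / 4 := by nlinarith [sq_nonneg (4 * b - v)]
    calc 2 * (b * (x * v)) = x * (2 * (b * v)) := by ring
      _ ≤ x * (4 * b ^ 2 + v ^ 2 / 4) := by gcongr
      _ ≤ _ := by gcongr
  have h3 : 0 ≤ m * (e * (a + b) ^ 2) := by positivity
  have h4 : 5 / 4 * m * v ^ 2 ≤ D * v ^ 2 := by gcongr
  have h5 : m * (e * (L ^ 2 * v ^ 2)) = m * v ^ 2 / 4 := by linear_combination m * v ^ 2 * heL
  have h6 : 0 ≤ m * v ^ 2 := by positivity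
  nlinarith

theorem aux_out (D x m a b v L e : ℝ) (hm : 0 < m) (hL : 1 ≤ L)
    (hD1 : 40 * L ^ 2 * m ≤ D) (hD2 : 40 * L ^ 2 * (x ^ 2 / m) ≤ D)
    (he : 0 < e) (heL : e * L ^ 2 = 1 / 4) :
    -D * v ^ 2 + 2 * ((a + b) * (x * v)) ≤
      m * (-(5 / 16) * v ^ 2 + 36 * (0 ^ 2 - 1 / 900 * v ^ 2) + 48 / 10 * (b ^ 2 - L ^ 2 * v ^ 2)
        + e * ((a + b) ^ 2 - L ^ 2 * v ^ 2)) := by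
  have h1 : 2 * ((a + b) * (x * v)) ≤ m * (e * (a + b) ^ 2) + 4 * L ^ 2 * (x ^ 2 / m) * v ^ 2 := by
    have hL2 : 4 * L ^ 2 = 1 / e := by field_simp; linarith
    have : m * (e * (a + b) ^ 2) + 4 * L ^ 2 * (x ^ 2 / m) * v ^ 2 - 2 * ((a + b) * (x * v))
        = (m * e * (a + b) - x * v) ^ 2 / (m * e) := by
      rw [hL2]; field_simp; ring
    have : 0 ≤ (m * e * (a + b) - x * v) ^ 2 / (m * e) := by positivity
    linarith
  have h4 : 40 * L ^ 2 * m * v ^ 2 ≤ D * v ^ 2 := by gcongr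
  have h4' : 40 * L ^ 2 * (x ^ 2 / m) * v ^ 2 ≤ D * v ^ 2 := by gcongr
  have h5 : m * (e * (L ^ 2 * v ^ 2)) = m * v ^ 2 / 4 := by linear_combination m * v ^ 2 * heL
  have h6 : 0 ≤ m * v ^ 2 := by positivity
  have h7 : 0 ≤ m * b ^ 2 := by positivity
  have h8 : m * v ^ 2 ≤ L ^ 2 * (m * v ^ 2) := by
    have : 1 ≤ L ^ 2 := by nlinarith
    nlinarith
  nlinarith

theorem aux_low (X x m K L : ℝ) (hm : 0 < m) (hx0 : 0 < x) (hX : m ≤ X)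
    (hK : 60 * L ^ 2 ≤ K) (hxK : x ^ 4 < m ^ 4 - K) :
    40 * L ^ 2 * m ≤ X ^ 5 + m ^ 5 - 2 * x ^ 5 ∧
    40 * L ^ 2 * (x ^ 2 / m) ≤ X ^ 5 + m ^ 5 - 2 * x ^ 5 := by
  have hL : 0 ≤ L ^ 2 := sq_nonneg L
  have hxm : x ≤ m := by
    by_contra hc
    have : m ^ 4 ≤ x ^ 4 := by gcongr; linarith
    linarith
  have h1 : m ^ 5 ≤ X ^ 5 := by gcongr
  have h2 : x ^ 5 ≤ m * x ^ 4 := by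
    have : x ^ 5 = x * x ^ 4 := by ring
    rw [this]; gcongr
  have h3 : 40 * L ^ 2 * m ≤ X ^ 5 + m ^ 5 - 2 * x ^ 5 := by nlinarith
  refine ⟨h3, le_trans ?_ h3⟩
  gcongr
  rw [div_le_iff₀ hm]
  nlinarith

theorem aux_high (X x m K L : ℝ) (hm : 0 < m) (hX0 : 0 < X) (hX : X ≤ x) (hmX : m ≤ X)
    (hK : 60 * L ^ 2 ≤ K) (hK2 : K < m ^ 4 / 2) (hxK : m ^ 4 + K < x ^ 4) :
    40 * L ^ 2 * m ≤ 2 * x ^ 5 - X ^ 5 - m ^ 5 ∧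
    40 * L ^ 2 * (x ^ 2 / m) ≤ 2 * x ^ 5 - X ^ 5 - m ^ 5 := by
  have hL : 0 ≤ L ^ 2 := sq_nonneg L
  have hxm : m ≤ x := hmX.trans hX
  have hx0 : 0 < x := by linarith
  have h1 : X ^ 5 ≤ x ^ 5 := by gcongr
  have h2 : x * (x ^ 4 - m ^ 4) ≤ x ^ 5 - m ^ 5 := by
    have : 0 ≤ m ^ 4 * (x - m) := mul_nonneg (by positivity) (by linarith)
    nlinarith
  have h3 : K * x ≤ 3 / 2 * (x ^ 4 - m ^ 4) * m := by
    have e1 : K * x ^ 4 ≤ 3 / 2 * (x ^ 4 - m ^ 4) * m ^ 4 := by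
      have hm4 : 0 < m ^ 4 := by positivity
      nlinarith [mul_nonneg (sub_nonneg.2 hxK.le) (sub_nonneg.2 hK2.le), mul_nonneg hL hm4.le]
    have e2 : m ^ 3 ≤ x ^ 3 := by gcongr
    have e3 : K * x * m ^ 3 ≤ K * x * x ^ 3 := by
      have : 0 ≤ K := by nlinarith
      gcongr
    have hm3 : 0 < m ^ 3 := by positivity
    refine le_of_mul_le_mul_right ?_ hm3
    calc K * x * m ^ 3 ≤ K * x * x ^ 3 := e3
      _ = K * x ^ 4 := by ring
      _ ≤ _ := e1
      _ = _ := by ring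
  have h4 : 40 * L ^ 2 * (x ^ 2 / m) ≤ 2 * x ^ 5 - X ^ 5 - m ^ 5 := by
    have : 40 * L ^ 2 * (x ^ 2 / m) ≤ x * (x ^ 4 - m ^ 4) := by
      rw [← mul_div_assoc, div_le_iff₀ hm]
      have : 60 * L ^ 2 * x ≤ K * x := by gcongr
      nlinarith
    linarith
  refine ⟨le_trans ?_ h4, h4⟩
  gcongr
  rw [le_div_iff₀ hm]
  nlinarith

/-- The pointwise inequality underlying Theorem 4.2 and Corollary 5.9 of the paper:
under the spatial averaging condition the strong cone condition holds (case α = 1/4). -/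
theorem spatial_averaging_strong_cone
    (lam : ℕ+ → ℝ) (hmono : Monotone lam) (hpos : ∀ j, 0 < lam j)
    (L : ℝ) (hL : 1 ≤ L) (δ : ℝ) (hδ0 : 0 < δ) (hδ1 : δ ≤ 1 / 30)
    (h : ℝ) (hh0 : 0 < h) (hh1 : h ≤ 1 / 2)
    (N : ℕ+) (hlamN : Real.exp (60 * L ^ 2 / h) ≤ lam N)
    (hgap1 : 1 ≤ lam (N + 1) - lam N) (hgap2 : lam (N + 1) - lam N ≤ 2 * L)
    (k : ℝ) (hk1 : h * Real.log (lam N) ≤ k) (hk2 : k < lam N / 2)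
    (T : (ℕ+ → ℝ) →ₗ[ℝ] (ℕ+ → ℝ))
    (hT : ∀ u : ℕ+ → ℝ, (Summable fun j => (u j) ^ 2) →
      (Summable fun j => (T u j) ^ 2) ∧ nsq (T u) ≤ L ^ 2 * nsq u)
    (hSAC : ∀ u : ℕ+ → ℝ, (Summable fun j => (u j) ^ 2) →
      nsq (RkOp lam k N (T (RkOp lam k N u))) ≤ δ ^ 2 * nsq u)
    (v : ℕ+ → ℝ)
    (hv2 : Summable fun j => (v j) ^ 2)
    (hv : Summable fun j => lam j ^ ((5 : ℝ) / 4) * (v j) ^ 2) :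
    (lam (N + 1) ^ ((5 : ℝ) / 4) + lam N ^ ((5 : ℝ) / 4)) *
          (nsq (Qhigh N v) - nsq (Plow N v)) -
        2 * (asq lam ((5 : ℝ) / 8) (Qhigh N v) - asq lam ((5 : ℝ) / 8) (Plow N v)) +
        2 * ∑' j, T v j *
          (lam j ^ ((1 : ℝ) / 4) * Plow N v j - lam j ^ ((1 : ℝ) / 4) * Qhigh N v j) ≤
      -((5 : ℝ) / 16) * lam N ^ ((1 : ℝ) / 4) * nsq v := by
  classical
  -- fourth roots
  set g : ℕ+ → ℝ := fun j => lam j ^ ((1 : ℝ) / 4) with hg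
  have hg0 : ∀ j, 0 < g j := fun j => Real.rpow_pos_of_pos (hpos j) _
  have hg4 : ∀ j, lam j = g j ^ 4 := fun j => by
    simp only [hg]; rw [← Real.rpow_natCast, ← Real.rpow_mul (hpos j).le]; norm_num
  have hg5 : ∀ j, lam j ^ ((5 : ℝ) / 4) = g j ^ 5 := fun j => by
    simp only [hg]; rw [← Real.rpow_natCast, ← Real.rpow_mul (hpos j).le]; norm_num
  have hgm : ∀ i j, i ≤ j → g i ≤ g j := fun i j hij =>
    Real.rpow_le_rpow (hpos i).le (hmono hij) (by norm_num)
  have hK : 60 * L ^ 2 ≤ k := by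
    have h1 : 60 * L ^ 2 / h ≤ Real.log (lam N) := (Real.le_log_iff_exp_le (hpos N)).2 hlamN
    rw [div_le_iff₀ hh0] at h1
    linarith
  have hk0 : 0 ≤ k := by nlinarith [sq_nonneg L]
  have hL2 : 0 < L ^ 2 := by positivity
  set e : ℝ := 1 / (4 * L ^ 2) with he
  have he0 : 0 < e := by positivity
  have heL : e * L ^ 2 = 1 / 4 := by rw [he]; field_simp
  -- decomposition
  set r := RkOp lam k N v with hr
  set w := v - r with hw
  have hTv : T v = T r + T w := by rw [← map_add, hw]; congr 1; abel
  have hw2 : Summable fun j => (w j) ^ 2 := by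
    refine Summable.of_nonneg_of_le (fun j => sq_nonneg _) (fun j => ?_) hv2
    simp only [hw, hr, Pi.sub_apply, RkOp]
    split_ifs <;> simp [sq_nonneg]
  have hr2 : Summable fun j => (r j) ^ 2 := by
    refine Summable.of_nonneg_of_le (fun j => sq_nonneg _) (fun j => ?_) hv2
    simp only [hr, RkOp]
    split_ifs <;> simp [sq_nonneg]
  set ρ := RkOp lam k N (T r) with hρ
  have hρ2 : Summable fun j => (ρ j) ^ 2 := by
    refine Summable.of_nonneg_of_le (fun j => sq_nonneg _) (fun j => ?_) (hT r hr2).1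
    simp only [hρ, RkOp]
    split_ifs <;> simp [sq_nonneg]
  obtain ⟨hb2, hbn⟩ := hT w hw2
  obtain ⟨ht2, htn⟩ := hT v hv2
  have hρn : nsq ρ ≤ 1 / 900 * nsq v := by
    refine (hSAC v hv2).trans ?_
    have : 0 ≤ nsq v := tsum_nonneg fun j => sq_nonneg _
    gcongr
    nlinarith
  -- summability
  have hp2 : Summable fun j => (Plow N v j) ^ 2 := by
    refine Summable.of_nonneg_of_le (fun j => sq_nonneg _) (fun j => ?_) hv2
    simp only [Plow]
    split_ifs <;> simp [sq_nonneg]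
  have hq2 : Summable fun j => (Qhigh N v j) ^ 2 := by
    refine Summable.of_nonneg_of_le (fun j => sq_nonneg _) (fun j => ?_) hv2
    simp only [Qhigh]
    split_ifs <;> simp [sq_nonneg]
  have h58 : (2 * ((5 : ℝ) / 8)) = 5 / 4 := by norm_num
  simp only [hg5] at hv
  have hpA : Summable fun j => g j ^ 5 * (Plow N v j) ^ 2 := by
    have hn : ∀ j, 0 ≤ g j ^ 5 := fun j => (pow_pos (hg0 j) 5).le
    refine Summable.of_nonneg_of_le (fun j => mul_nonneg (hn j) (sq_nonneg _)) (fun j => ?_) hv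
    refine mul_le_mul_of_nonneg_left ?_ (hn j)
    simp only [Plow]
    split_ifs <;> simp [sq_nonneg]
  have hqA : Summable fun j => g j ^ 5 * (Qhigh N v j) ^ 2 := by
    have hn : ∀ j, 0 ≤ g j ^ 5 := fun j => (pow_pos (hg0 j) 5).le
    refine Summable.of_nonneg_of_le (fun j => mul_nonneg (hn j) (sq_nonneg _)) (fun j => ?_) hv
    refine mul_le_mul_of_nonneg_left ?_ (hn j)
    simp only [Qhigh]
    split_ifs <;> simp [sq_nonneg]
  have hI : Summable fun j => T v j * (g j * Plow N v j - g j * Qhigh N v j) := by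
    refine Summable.of_norm_bounded (g := fun j => (T v j) ^ 2 + ((v j) ^ 2 + g j ^ 5 * (v j) ^ 2))
      (ht2.add (hv2.add hv)) (fun j => ?_)
    have hz : (g j * Plow N v j - g j * Qhigh N v j) ^ 2 = g j ^ 2 * (v j) ^ 2 := by
      simp only [Plow, Qhigh]
      split_ifs <;> ring
    have hx : g j ^ 2 ≤ 1 + g j ^ 5 := by
      have := hg0 j
      rcases le_total (g j) 1 with h1 | h1
      · have : g j ^ 2 ≤ 1 := pow_le_one₀ this.le h1
        have h5 : 0 ≤ g j ^ 5 := (pow_pos (hg0 j) 5).le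
        linarith
      · have : g j ^ 2 ≤ g j ^ 5 := pow_le_pow_right₀ h1 (by norm_num)
        linarith
    have hx2 : g j ^ 2 * (v j) ^ 2 ≤ (1 + g j ^ 5) * (v j) ^ 2 := by gcongr
    rw [Real.norm_eq_abs]
    generalize g j * Plow N v j - g j * Qhigh N v j = z at *
    refine abs_le.2 ⟨?_, ?_⟩ <;>
      nlinarith [sq_nonneg (T v j - z), sq_nonneg (T v j + z), sq_nonneg (T v j), sq_nonneg z]
  -- pointwise inequality
  have hgap : 5 / 4 * g N ≤ g (N + 1) ^ 5 - g N ^ 5 := by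
    refine aux_gap _ _ (hg0 _) (hg0 _) ?_
    rw [← hg4, ← hg4]; exact hgap1
  have hNN : g N ≤ g (N + 1) := hgm _ _ (PNat.lt_add_right N 1).le
  have hpt : ∀ j, (g (N + 1) ^ 5 + g N ^ 5) * ((Qhigh N v j) ^ 2 - (Plow N v j) ^ 2)
      - 2 * (g j ^ 5 * (Qhigh N v j) ^ 2 - g j ^ 5 * (Plow N v j) ^ 2)
      + 2 * (T v j * (g j * Plow N v j - g j * Qhigh N v j)) ≤
      g N * (-(5 / 16) * (v j) ^ 2 + 36 * ((ρ j) ^ 2 - 1 / 900 * (v j) ^ 2)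
        + 48 / 10 * ((T w j) ^ 2 - L ^ 2 * (w j) ^ 2)
        + e * ((T v j) ^ 2 - L ^ 2 * (v j) ^ 2)) := by
    intro j
    have htj : T v j = T r j + T w j := by rw [hTv]; rfl
    rw [htj]
    by_cases hR : lam N - k ≤ lam j ∧ lam j ≤ lam N + k
    · have e1 : ρ j = T r j := by simp only [hρ, RkOp]; rw [if_pos hR]
      have e2 : w j = 0 := by simp only [hw, hr, Pi.sub_apply, RkOp]; rw [if_pos hR]; ring
      rw [e1, e2]
      have hx : g j ≤ 12 / 10 * g N := by
        by_contra hc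
        have h1 : (12 / 10 * g N) ^ 4 ≤ g j ^ 4 := by
          have := hg0 N
          gcongr
          linarith
        have h2 := hR.2
        rw [hg4 N] at hk2 h2
        rw [hg4 j] at h2
        have := pow_pos (hg0 N) 4
        nlinarith
      by_cases hj : j ≤ N
      · simp only [Plow, Qhigh, if_pos hj]
        have hjN : g j ^ 5 ≤ g N ^ 5 := by
          have := hg0 j
          gcongr
          exact hgm _ _ hj
        refine le_trans (le_of_eq ?_) (aux_in (g (N + 1) ^ 5 + g N ^ 5 - 2 * g j ^ 5) (g j) (g N)
          (T r j) (T w j) (v j) L e (hg0 N) (by linarith) (hg0 j) hx he0 heL)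
        ring
      · simp only [Plow, Qhigh, if_neg hj]
        have hjN : g (N + 1) ^ 5 ≤ g j ^ 5 := by
          have := hg0 (N + 1)
          gcongr
          exact hgm _ _ (PNat.add_one_le_iff.2 (not_le.1 hj))
        refine le_trans (le_of_eq ?_) (le_trans
          (aux_in (2 * g j ^ 5 - g (N + 1) ^ 5 - g N ^ 5) (g j) (g N)
          (T r j) (T w j) (-v j) L e (hg0 N) (by linarith) (hg0 j) hx he0 heL) (le_of_eq ?_))
        · ring
        · ring
    · have e1 : ρ j = 0 := by simp only [hρ, RkOp]; rw [if_neg hR]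
      have e2 : w j = v j := by simp only [hw, hr, Pi.sub_apply, RkOp]; rw [if_neg hR]; ring
      rw [e1, e2]
      by_cases hj : j ≤ N
      · simp only [Plow, Qhigh, if_pos hj]
        have hlt : g j ^ 4 < g N ^ 4 - k := by
          rw [← hg4, ← hg4]
          by_contra hc
          exact hR ⟨not_lt.1 hc, by linarith [hmono hj]⟩
        obtain ⟨d1, d2⟩ := aux_low (g (N + 1)) (g j) (g N) k L (hg0 N) (hg0 j) hNN hK hlt
        refine le_trans (le_of_eq ?_) (aux_out (g (N + 1) ^ 5 + g N ^ 5 - 2 * g j ^ 5) (g j) (g N)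
          (T r j) (T w j) (v j) L e (hg0 N) hL d1 d2 he0 heL)
        ring
      · simp only [Plow, Qhigh, if_neg hj]
        have hlt : g N ^ 4 + k < g j ^ 4 := by
          rw [← hg4, ← hg4]
          by_contra hc
          exact hR ⟨by linarith [hmono (not_le.1 hj).le], not_lt.1 hc⟩
        obtain ⟨d1, d2⟩ := aux_high (g (N + 1)) (g j) (g N) k L (hg0 N) (hg0 _)
          (hgm _ _ (PNat.add_one_le_iff.2 (not_le.1 hj))) hNN hK (by rw [← hg4]; exact hk2) hlt
        refine le_trans (le_of_eq ?_) (le_trans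
          (aux_out (2 * g j ^ 5 - g (N + 1) ^ 5 - g N ^ 5) (g j) (g N)
          (T r j) (T w j) (-v j) L e (hg0 N) hL d1 d2 he0 heL) (le_of_eq ?_))
        · ring
        · ring
  -- summation
  have SL := (((hq2.hasSum.sub hp2.hasSum).mul_left (g (N + 1) ^ 5 + g N ^ 5)).sub
    ((hqA.hasSum.sub hpA.hasSum).mul_left 2)).add (hI.hasSum.mul_left 2)
  have SR := ((((hv2.hasSum.mul_left (-(5 / 16 : ℝ))).add
    ((hρ2.hasSum.sub (hv2.hasSum.mul_left (1 / 900 : ℝ))).mul_left 36)).add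
    ((hb2.hasSum.sub (hw2.hasSum.mul_left (L ^ 2))).mul_left (48 / 10))).add
    ((ht2.hasSum.sub (hv2.hasSum.mul_left (L ^ 2))).mul_left e)).mul_left (g N)
  have main := hasSum_le hpt SL SR
  simp only [asq, h58, hg5]
  change (g (N + 1) ^ 5 + g N ^ 5) * (nsq (Qhigh N v) - nsq (Plow N v)) - _ + 2 * _ ≤
    -(5 / 16) * g N * nsq v
  refine main.trans ?_
  change g N * (-(5 / 16) * nsq v + 36 * (nsq ρ - 1 / 900 * nsq v)
    + 48 / 10 * (nsq (T w) - L ^ 2 * nsq w) + e * (nsq (T v) - L ^ 2 * nsq v)) ≤ _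
  have z1 : e * (nsq (T v) - L ^ 2 * nsq v) ≤ 0 :=
    mul_nonpos_of_nonneg_of_nonpos he0.le (by linarith)
  calc _ ≤ g N * (-(5 / 16) * nsq v) := by
        refine mul_le_mul_of_nonneg_left ?_ (hg0 N).le
        linarith
    _ = _ := by ring
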